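/- arXiv:2201.06762 — 2 statements merged into one kernel-verified Lean document; each statement's English description precedes it below -/
import Mathlib

section
/- Let A be a local unique factorization domain with maximal ideal 𝔪, and let f₁, f₂ be nonzero elements of 𝔪 such that neither of f₁, f₂ divides the other and such that f₁, f₂ is not an A-regular sequence. Then there exist an element g ∈ 𝔪 and elements f₁′, f₂′ ∈ A such that f₁ = g·f₁′, f₂ = g·f₂′, and f₁′, f₂′ is an A-regular sequence. -/
open IsLocalRing

open RingTheory.Sequence in
/-- In a local domain whose multiplicative monoid has the decomposition property, two coprime
nonunits, the first of them nonzero, form a regular sequence. -/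
theorem IsRelPrime.isRegular_pair {A : Type*} [CommRing A] [IsDomain A] [DecompositionMonoid A]
    [IsLocalRing A] {a b : A} (hab : IsRelPrime a b) (ha₀ : a ≠ 0)
    (ha : a ∈ maximalIdeal A) (hb : b ∈ maximalIdeal A) : IsRegular A [a, b] := by
  rw [IsLocalRing.isRegular_iff_isWeaklyRegular_of_subset_maximalIdeal (by simpa using ⟨ha, hb⟩),
    isWeaklyRegular_cons_iff, isWeaklyRegular_singleton_iff]
  refine ⟨fun x y h => mul_left_cancel₀ ha₀ h, ?_⟩
  refine (isSMulRegular_quotient_iff_mem_of_smul_mem _ _).mpr ?_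
  intro x hx
  rw [Submodule.mem_smul_pointwise_iff_exists] at hx ⊢
  obtain ⟨y, -, hy⟩ := hx
  obtain ⟨z, rfl⟩ := hab.dvd_of_dvd_mul_left (Dvd.intro y hy : a ∣ b * x)
  exact ⟨z, trivial, rfl⟩

/-- In a local UFD `A`, if `f₁, f₂` are nonzero elements of the maximal
ideal, neither dividing the other, which do not form a regular sequence, then there are
`g ∈ 𝔪` and `f₁′, f₂′` with `f₁ = g·f₁′`, `f₂ = g·f₂′` and `f₁′, f₂′` a regular sequence. -/
theorem stmt_5 (A : Type) [CommRing A] [IsDomain A] [UniqueFactorizationMonoid A]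
    [IsLocalRing A] (f₁ f₂ : A)
    (h₁ : f₁ ∈ maximalIdeal A) (h₂ : f₂ ∈ maximalIdeal A)
    (hf₁ : f₁ ≠ 0) (hf₂ : f₂ ≠ 0)
    (h12 : ¬ f₁ ∣ f₂) (h21 : ¬ f₂ ∣ f₁)
    (hreg : ¬ RingTheory.Sequence.IsRegular A [f₁, f₂]) :
    ∃ g ∈ maximalIdeal A, ∃ f₁' f₂' : A,
      f₁ = g * f₁' ∧ f₂ = g * f₂' ∧ RingTheory.Sequence.IsRegular A [f₁', f₂'] := by
  obtain ⟨a, b, g, hab, rfl, rfl⟩ := UniqueFactorizationMonoid.exists_reduced_factors f₁ hf₁ f₂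
  refine ⟨g, fun hg => hreg ?_, a, b, rfl, rfl, ?_⟩
  · exact IsRelPrime.isRegular_pair
      ((isRelPrime_mul_unit_left hg).mpr hab) hf₁ h₁ h₂
  · refine hab.isRegular_pair (right_ne_zero_of_mul hf₁) (fun ha => h12 ?_) (fun hb => h21 ?_)
    · exact mul_dvd_mul_left g ha.dvd
    · exact mul_dvd_mul_left g hb.dvd
end

section
/- Let A be a local unique factorization domain with maximal ideal 𝔪, let g ∈ 𝔪 be nonzero, and let f₁′, f₂′ ∈ A be nonzero elements whose only common divisors are units. Set f₁ = g·f₁′ and f₂ = g·f₂′. Then the sequence of A-modules 0 → A → A² → A → A/(f₁, f₂) → 0, with maps a ↦ (−a·f₂′, a·f₁′), (x, y) ↦ x·f₁ + y·f₂, and the canonical projection, is exact; that is, the first map is injective, its image equals the kernel of the second map, and the image of the second map is the ideal (f₁, f₂). In particular, A/(f₁, f₂) has projective dimension at most 2 over A. -/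
open IsLocalRing

/-- In a local UFD `A`, let `g ∈ 𝔪` be nonzero and `f₁′, f₂′` nonzero
coprime elements, and set `f₁ = g·f₁′`, `f₂ = g·f₂′`. Then the sequence
`0 → A → A² → A → A/(f₁,f₂) → 0` with maps `a ↦ (−a·f₂′, a·f₁′)` and
`(x,y) ↦ x·f₁ + y·f₂` followed by the projection is exact: the first map is injective,
its image is the kernel of the second, and the image of the second is the ideal `(f₁,f₂)`. -/
theorem stmt_6 (A : Type) [CommRing A] [IsDomain A] [UniqueFactorizationMonoid A]
    [IsLocalRing A] (g f₁' f₂' : A)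
    (hg : g ∈ maximalIdeal A) (hg0 : g ≠ 0) (h1 : f₁' ≠ 0) (h2 : f₂' ≠ 0)
    (hcop : ∀ d : A, d ∣ f₁' → d ∣ f₂' → IsUnit d)
    (f₁ f₂ : A) (hf₁ : f₁ = g * f₁') (hf₂ : f₂ = g * f₂') :
    Function.Injective
        (LinearMap.prod ((-f₂') • (LinearMap.id : A →ₗ[A] A))
          (f₁' • (LinearMap.id : A →ₗ[A] A))) ∧
      LinearMap.range
          (LinearMap.prod ((-f₂') • (LinearMap.id : A →ₗ[A] A))
            (f₁' • (LinearMap.id : A →ₗ[A] A)))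
        = LinearMap.ker ((LinearMap.lsmul A A f₁).coprod (LinearMap.lsmul A A f₂)) ∧
      LinearMap.range ((LinearMap.lsmul A A f₁).coprod (LinearMap.lsmul A A f₂))
        = Ideal.span {f₁, f₂} := by
  subst hf₁ hf₂
  have hrel : IsRelPrime f₁' f₂' := fun d => hcop d
  refine ⟨fun a b hab => ?_, ?_, ?_⟩
  · have hsnd : f₁' * a = f₁' * b := by simpa using congrArg Prod.snd hab
    exact mul_left_cancel₀ h1 hsnd
  · ext ⟨x, y⟩
    simp only [LinearMap.mem_range, LinearMap.mem_ker, LinearMap.prod_apply, Function.prod,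
      LinearMap.smul_apply, LinearMap.id_apply, LinearMap.coprod_apply, LinearMap.lsmul_apply,
      smul_eq_mul, Prod.mk.injEq]
    constructor
    · rintro ⟨a, rfl, rfl⟩
      ring
    · intro h
      have hsyz : f₁' * x + f₂' * y = 0 :=
        mul_left_cancel₀ hg0 (by linear_combination h)
      obtain ⟨a, rfl⟩ : f₁' ∣ y :=
        hrel.dvd_of_dvd_mul_left ⟨-x, by linear_combination hsyz⟩
      exact ⟨a, mul_left_cancel₀ h1 (by linear_combination -hsyz), rfl⟩
  · ext z
    simp [Ideal.mem_span_pair, mul_comm]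
end
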